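/- The Peregrine soliton ψ(x,t) = (1/√g₂) · [ (4 + 8i(t − t₀)) / (1 + 4(t − t₀)² + (2/g₁)(x − x₀)²) − 1 ] · exp(i(t − t₀ + φ₀)) satisfies the nonlinear Schrödinger equation i∂ψ/∂t + g₁∂²ψ/∂x² + g₂|ψ|²ψ = 0. -/

import Mathlib

/-- The Peregrine soliton satisfies the nonlinear Schrödinger equation. -/
theorem peregrine_soliton_solves_nlse (g₁ g₂ x₀ t₀ φ₀ : ℝ)
    (hg₁ : g₁ > 0) (hg₂ : g₂ > 0)
    (ψ : ℝ → ℝ → ℂ)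
    (hψ : ∀ x t : ℝ, ψ x t =
      ((1 / Real.sqrt g₂ : ℝ) : ℂ) *
        (((4 : ℂ) + Complex.I * 8 * ((t - t₀ : ℝ) : ℂ)) /
            (((1 + 4 * (t - t₀) ^ 2 + (2 / g₁) * (x - x₀) ^ 2 : ℝ)) : ℂ) - 1) *
        Complex.exp (Complex.I * ((t - t₀ + φ₀ : ℝ) : ℂ))) :
    ∀ x t : ℝ,
      Complex.I * deriv (fun s => ψ x s) t
        + (g₁ : ℂ) * deriv (fun y => deriv (fun z => ψ z t) y) x
        + (g₂ : ℂ) * (‖ψ x t‖ : ℂ) ^ 2 * ψ x t = 0 := by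
  intro x t
  have hpos : ∀ y s : ℝ, (((1 + 4 * (s - t₀) ^ 2 + (2 / g₁) * (y - x₀) ^ 2 : ℝ)) : ℂ) ≠ 0 := by
    intro y s
    have : 0 < 1 + 4 * (s - t₀) ^ 2 + (2 / g₁) * (y - x₀) ^ 2 := by positivity
    exact_mod_cast this.ne'
  have hg : (g₁ : ℂ) ≠ 0 := by exact_mod_cast hg₁.ne'
  -- time derivative
  have ht : HasDerivAt (fun s => ψ x s)
      (((1 / Real.sqrt g₂ : ℝ) : ℂ) *
        ((Complex.I * 8 * (((1 + 4 * (t - t₀) ^ 2 + (2 / g₁) * (x - x₀) ^ 2 : ℝ)) : ℂ)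
          - ((4 : ℂ) + Complex.I * 8 * ((t - t₀ : ℝ) : ℂ)) * ((8 * (t - t₀) : ℝ) : ℂ)) /
            (((1 + 4 * (t - t₀) ^ 2 + (2 / g₁) * (x - x₀) ^ 2 : ℝ)) : ℂ) ^ 2) *
        Complex.exp (Complex.I * ((t - t₀ + φ₀ : ℝ) : ℂ)) +
       ((1 / Real.sqrt g₂ : ℝ) : ℂ) *
        (((4 : ℂ) + Complex.I * 8 * ((t - t₀ : ℝ) : ℂ)) /
            (((1 + 4 * (t - t₀) ^ 2 + (2 / g₁) * (x - x₀) ^ 2 : ℝ)) : ℂ) - 1) *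
        (Complex.exp (Complex.I * ((t - t₀ + φ₀ : ℝ) : ℂ)) * Complex.I)) t := by
    simp only [hψ]
    have h1 : HasDerivAt (fun s : ℝ => s - t₀) 1 t := (hasDerivAt_id t).sub_const t₀
    have hN : HasDerivAt (fun s : ℝ => (4 : ℂ) + Complex.I * 8 * ((s - t₀ : ℝ) : ℂ))
        (Complex.I * 8) t := by
      simpa using (h1.ofReal_comp.const_mul (Complex.I * 8)).const_add 4
    have hD0 : HasDerivAt (fun s : ℝ => 1 + 4 * (s - t₀) ^ 2 + (2 / g₁) * (x - x₀) ^ 2)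
        (8 * (t - t₀)) t := by
      refine ((((h1.pow 2).const_mul 4).const_add 1).add_const _).congr_deriv ?_
      norm_num
      ring
    have hE0 : HasDerivAt (fun s : ℝ => Complex.I * ((s - t₀ + φ₀ : ℝ) : ℂ)) Complex.I t := by
      simpa using ((h1.add_const φ₀).ofReal_comp.const_mul Complex.I)
    exact ((((hN.div hD0.ofReal_comp (hpos x t)).sub_const 1).const_mul _).mul hE0.cexp)
  have hD1 : ∀ y, HasDerivAt
      (fun z : ℝ => ((1 + 4 * (t - t₀) ^ 2 + (2 / g₁) * (z - x₀) ^ 2 : ℝ) : ℂ))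
      (((4 / g₁) * (y - x₀) : ℝ) : ℂ) y := by
    intro y
    have h1 : HasDerivAt (fun s : ℝ => s - x₀) 1 y := (hasDerivAt_id y).sub_const x₀
    refine HasDerivAt.ofReal_comp ((((h1.pow 2).const_mul (2 / g₁)).const_add _).congr_deriv ?_)
    norm_num
    ring
  have hx1 : ∀ y, deriv (fun z => ψ z t) y =
      ((1 / Real.sqrt g₂ : ℝ) : ℂ) *
        (-(((4 : ℂ) + Complex.I * 8 * ((t - t₀ : ℝ) : ℂ)) * (((4 / g₁) * (y - x₀) : ℝ) : ℂ)) /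
            (((1 + 4 * (t - t₀) ^ 2 + (2 / g₁) * (y - x₀) ^ 2 : ℝ)) : ℂ) ^ 2) *
        Complex.exp (Complex.I * ((t - t₀ + φ₀ : ℝ) : ℂ)) := by
    intro y
    simp only [hψ]
    refine (HasDerivAt.congr_deriv (((((hasDerivAt_const y ((4 : ℂ) + Complex.I * 8 *
      ((t - t₀ : ℝ) : ℂ))).div (hD1 y) (hpos y t)).sub_const 1).const_mul _).mul_const _) ?_).deriv
    rw [zero_mul, zero_sub]
  have hx2 : deriv (fun y => deriv (fun z => ψ z t) y) x =
      ((1 / Real.sqrt g₂ : ℝ) : ℂ) *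
        ((-(((4 : ℂ) + Complex.I * 8 * ((t - t₀ : ℝ) : ℂ)) * ((4 / g₁ : ℝ) : ℂ)) *
            (((1 + 4 * (t - t₀) ^ 2 + (2 / g₁) * (x - x₀) ^ 2 : ℝ)) : ℂ) ^ 2 -
          -(((4 : ℂ) + Complex.I * 8 * ((t - t₀ : ℝ) : ℂ)) * (((4 / g₁) * (x - x₀) : ℝ) : ℂ)) *
            (2 * (((1 + 4 * (t - t₀) ^ 2 + (2 / g₁) * (x - x₀) ^ 2 : ℝ)) : ℂ) *
              (((4 / g₁) * (x - x₀) : ℝ) : ℂ))) /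
            ((((1 + 4 * (t - t₀) ^ 2 + (2 / g₁) * (x - x₀) ^ 2 : ℝ)) : ℂ) ^ 2) ^ 2) *
        Complex.exp (Complex.I * ((t - t₀ + φ₀ : ℝ) : ℂ)) := by
    simp only [hx1]
    have h1 : HasDerivAt (fun s : ℝ => (4 / g₁) * (s - x₀)) (4 / g₁) x := by
      simpa using ((hasDerivAt_id x).sub_const x₀).const_mul (4 / g₁)
    have hN := (h1.ofReal_comp.const_mul ((4 : ℂ) + Complex.I * 8 * ((t - t₀ : ℝ) : ℂ))).neg
    have hD2 : HasDerivAt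
        (fun z : ℝ => ((1 + 4 * (t - t₀) ^ 2 + (2 / g₁) * (z - x₀) ^ 2 : ℝ) : ℂ) ^ 2) _ x :=
      (hD1 x).pow 2
    refine (HasDerivAt.congr_deriv (((hN.div hD2 (pow_ne_zero 2 (hpos x t))).const_mul
      _).mul_const _) ?_).deriv
    norm_num
  have hnorm : (g₂ : ℂ) * (‖ψ x t‖ : ℂ) ^ 2 =
      (((4 : ℂ) + Complex.I * 8 * ((t - t₀ : ℝ) : ℂ)) /
            (((1 + 4 * (t - t₀) ^ 2 + (2 / g₁) * (x - x₀) ^ 2 : ℝ)) : ℂ) - 1) *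
      (((4 : ℂ) - Complex.I * 8 * ((t - t₀ : ℝ) : ℂ)) /
            (((1 + 4 * (t - t₀) ^ 2 + (2 / g₁) * (x - x₀) ^ 2 : ℝ)) : ℂ) - 1) := by
    have hE : ‖Complex.exp (Complex.I * ((t - t₀ + φ₀ : ℝ) : ℂ))‖ = 1 := by
      rw [mul_comm]; exact Complex.norm_exp_ofReal_mul_I _
    have hc : g₂ * ‖((1 / Real.sqrt g₂ : ℝ) : ℂ)‖ ^ 2 = 1 := by
      rw [Complex.norm_real, Real.norm_eq_abs, sq_abs, div_pow, Real.sq_sqrt hg₂.le]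
      field_simp
    have h2 : g₂ * ‖ψ x t‖ ^ 2 = ‖(((4 : ℂ) + Complex.I * 8 * ((t - t₀ : ℝ) : ℂ)) /
            (((1 + 4 * (t - t₀) ^ 2 + (2 / g₁) * (x - x₀) ^ 2 : ℝ)) : ℂ) - 1)‖ ^ 2 := by
      rw [hψ, norm_mul, norm_mul, hE, mul_one, mul_pow, ← mul_assoc, hc, one_mul]
    have h3 : (g₂ : ℂ) * (‖ψ x t‖ : ℂ) ^ 2 = ((g₂ * ‖ψ x t‖ ^ 2 : ℝ) : ℂ) := by push_cast; rfl
    rw [h3, h2, Complex.ofReal_pow, ← Complex.mul_conj']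
    congr 1
    simp only [map_sub, map_div₀, map_add, map_mul, Complex.conj_I, Complex.conj_ofReal, map_one,
      map_ofNat]
    ring
  rw [ht.deriv, hx2, hnorm, hψ]
  have hD := hpos x t
  have hDe : (((1 + 4 * (t - t₀) ^ 2 + (2 / g₁) * (x - x₀) ^ 2 : ℝ)) : ℂ) =
    1 + 4 * ((t - t₀ : ℝ) : ℂ) ^ 2 + 2 / (g₁ : ℂ) * ((x - x₀ : ℝ) : ℂ) ^ 2 := by push_cast; rfl
  rw [Complex.ofReal_mul (4 / g₁) (x - x₀), Complex.ofReal_div 4 g₁, Complex.ofReal_mul 8 (t - t₀)]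
  generalize (((1 + 4 * (t - t₀) ^ 2 + (2 / g₁) * (x - x₀) ^ 2 : ℝ)) : ℂ) = D at *
  generalize Complex.exp (Complex.I * ((t - t₀ + φ₀ : ℝ) : ℂ)) = E
  generalize ((1 / Real.sqrt g₂ : ℝ) : ℂ) = c
  generalize ((t - t₀ : ℝ) : ℂ) = T at *
  generalize ((x - x₀ : ℝ) : ℂ) = X at *
  generalize (g₁ : ℂ) = g at *
  have hI : Complex.I ^ 2 = -1 := Complex.I_sq
  generalize Complex.I = I at *
  have hX : X ^ 2 = g * (D - 1 - 4 * T ^ 2) / 2 := by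
    rw [hDe]; field_simp; ring
  have h8 : ((8 : ℝ) : ℂ) = 8 := by norm_num
  have h4 : ((4 : ℝ) : ℂ) = 4 := by norm_num
  rw [h8, h4]
  clear hDe
  have key : I * ((I * 8 * D - (4 + I * 8 * T) * (8 * T)) / D ^ 2)
      + I * (((4 + I * 8 * T) / D - 1) * I)
      + (-4 * (4 + I * 8 * T) / D ^ 2 + 32 * (X ^ 2 / g) * (4 + I * 8 * T) / D ^ 3)
      + ((4 + I * 8 * T) / D - 1) * ((4 - I * 8 * T) / D - 1) * ((4 + I * 8 * T) / D - 1) = 0 := by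
    rw [hX]
    field_simp
    ring_nf
    have hI3 : I ^ 3 = -I := by rw [pow_succ, hI]; ring
    simp only [hI, hI3]
    ring
  have e : g * (c * ((-((4 + I * 8 * T) * (4 / g)) * D ^ 2 -
      -((4 + I * 8 * T) * (4 / g * X)) * (2 * D * (4 / g * X))) / (D ^ 2) ^ 2) * E) =
      c * E * (-4 * (4 + I * 8 * T) / D ^ 2 + 32 * (X ^ 2 / g) * (4 + I * 8 * T) / D ^ 3) := by
    field_simp
    ring
  rw [e]
  linear_combination (c * E) * key
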